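/- arXiv:1602.08563 — 2 statements merged into one kernel-verified Lean document; each statement's English description precedes it below -/
import Mathlib

section
/- Consider a phase of the algorithm TC. For every time t > begin(P) the following invariants hold: (1) cnt_{t−1}(X) < |X|·α for every valid changeset X for C_t; (2) cnt_t(X) ≤ |X|·α for every valid changeset X for C_t; (3) every valid changeset X for C_t with cnt_t(X) = |X|·α contains the node requested at round t. -/
open scoped Classical

/-!
Common setup for the online tree caching problem
(Bienkowski, Marcinkowski, Pacut, Schmid, Spyra, "Online Tree Caching").
-/

/-- A finite rooted tree on the vertex type `V`: every vertex has a parent,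
the root is its own parent, and iterating `parent` from any vertex reaches the root. -/
structure RTree (V : Type) where
  root : V
  parent : V → V
  parent_root : parent root = root
  reaches_root : ∀ v : V, ∃ n : ℕ, parent^[n] v = root

namespace RTree

variable {V : Type}

/-- The subtree `T(u)`: `u` together with all its descendants. -/
def subtree (T : RTree V) (u : V) : Set V :=
  {v | ∃ n : ℕ, T.parent^[n] v = u}

/-- `C` is a subforest of `T`: with every node it contains the whole subtree below it. -/
def Subforest (T : RTree V) (C : Set V) : Prop :=
  ∀ v ∈ C, T.subtree v ⊆ C

/-- `A` is a tree cap rooted at `v`: `A ⊆ T(v)`, `v ∈ A`, and `A` is closed under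
taking the parent (towards `v`). -/
def TreeCap (T : RTree V) (v : V) (A : Set V) : Prop :=
  A ⊆ T.subtree v ∧ v ∈ A ∧ ∀ u ∈ A, u ≠ v → T.parent u ∈ A

/-- `X` is a valid positive changeset for the cache `C`. -/
def ValidPos (T : RTree V) (C X : Set V) : Prop :=
  X.Nonempty ∧ X ∩ C = ∅ ∧ T.Subforest (C ∪ X)

/-- `X` is a valid negative changeset for the cache `C`. -/
def ValidNeg (T : RTree V) (C X : Set V) : Prop :=
  X.Nonempty ∧ X ⊆ C ∧ T.Subforest (C \ X)

/-- `X` is a valid changeset for the cache `C`. -/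
def Valid (T : RTree V) (C X : Set V) : Prop :=
  T.ValidPos C X ∨ T.ValidNeg C X

/-- `w` is the root of a tree (connected component) of the subforest `C`. -/
def IsCompRoot (T : RTree V) (C : Set V) (w : V) : Prop :=
  w ∈ C ∧ (w = T.root ∨ T.parent w ∉ C)

/-- The depth of a node: its distance to the root. -/
noncomputable def depth [DecidableEq V] (T : RTree V) (v : V) : ℕ :=
  Nat.find (T.reaches_root v)

/-- The height `h(T)` of the tree: its number of levels. -/
noncomputable def height [Fintype V] [DecidableEq V] (T : RTree V) : ℕ :=
  (Finset.univ.sup fun v => T.depth v) + 1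

end RTree

/-- A request: a node together with a sign (`true` = positive, `false` = negative). -/
abbrev Request (V : Type) := V × Bool

/-- The request `r` incurs cost `1` when the cache is `C`
(a positive request to a non-cached node, or a negative request to a cached node). -/
def Costly {V : Type} (r : Request V) (C : Set V) : Prop :=
  (r.2 = true ∧ r.1 ∉ C) ∨ (r.2 = false ∧ r.1 ∈ C)

/-- The sum of the counters `f` over the set of nodes `A`. -/
noncomputable def cntSum {V : Type} [Fintype V] (f : V → ℕ) (A : Set V) : ℕ :=
  ∑ v : V, A.indicator f v

/-- The number of nodes of a changeset (`0` for no changeset). -/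
noncomputable def chgSize {V : Type} : Option (Set V) → ℕ
  | none => 0
  | some X => X.ncard

/-- One phase of the algorithm `TC` on the request sequence `req` (the request of
round `t ≥ 1` is `req t`), starting at time `0` with an empty cache.
`cache t` is the cache contents during round `t`; `cnt t` are the counter values just
after serving the request of round `t` (used for the decision at time `t`);
`chg t` is the changeset applied at time `t` (right after round `t`), if any. -/
structure TCPhase {V : Type} [Fintype V] [DecidableEq V]
    (T : RTree V) (α : ℕ) (req : ℕ → Request V) where
  cache : ℕ → Set V
  cnt : ℕ → V → ℕ
  chg : ℕ → Option (Set V)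
  cache_subforest : ∀ t, T.Subforest (cache t)
  cache_zero : cache 0 = ∅
  cnt_zero : ∀ v, cnt 0 v = 0
  cnt_rec : ∀ t v, cnt (t + 1) v =
    (if ∃ X, chg t = some X ∧ v ∈ X then 0 else cnt t v)
    + (if (req (t + 1)).1 = v ∧ Costly (req (t + 1)) (cache (t + 1)) then 1 else 0)
  step_some : ∀ t X, chg t = some X →
    T.Valid (cache t) X ∧
    X.ncard * α ≤ cntSum (cnt t) X ∧
    (∀ Y, T.Valid (cache t) Y → X ⊂ Y → cntSum (cnt t) Y < Y.ncard * α) ∧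
    cache (t + 1) = if T.ValidPos (cache t) X then cache t ∪ X else cache t \ X
  step_none : ∀ t, chg t = none →
    cache (t + 1) = cache t ∧
    ∀ X, T.Valid (cache t) X → cntSum (cnt t) X < X.ncard * α

namespace TCPhase

variable {V : Type} [Fintype V] [DecidableEq V]
  {T : RTree V} {α : ℕ} {req : ℕ → Request V}

/-- The counter values at time `t`, right after the cache change at time `t`
(counters of fetched/evicted nodes are reset to `0`). -/
noncomputable def cntPost (E : TCPhase T α req) (t : ℕ) (v : V) : ℕ :=
  if ∃ X, E.chg t = some X ∧ v ∈ X then 0 else E.cnt t v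

/-- `last_v(t)`: the last time strictly before `t` at which `v` changed its
cached/non-cached state (`0`, the beginning of the phase, if there is none). -/
noncomputable def lastChg (E : TCPhase T α req) (v : V) (t : ℕ) : ℕ :=
  ((Finset.range t).filter fun s => ¬ ((v ∈ E.cache s) ↔ v ∈ E.cache (s + 1))).sup id

/-- The slot `(v, r)` belongs to the field `F^t`. -/
def inField (E : TCPhase T α req) (t : ℕ) (v : V) (r : ℕ) : Prop :=
  ∃ X, E.chg t = some X ∧ v ∈ X ∧ E.lastChg v t < r ∧ r ≤ t

/-- The number of requests of the sequence `ρ` lying in slots of `F^t_{≤ τ} ∩ D`. -/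
noncomputable def fieldReqIn (E : TCPhase T α req) (ρ : ℕ → Request V)
    (t : ℕ) (D : Set V) (τ : ℕ) : ℕ :=
  ((Finset.Icc 1 t).filter fun r => r ≤ τ ∧ (ρ r).1 ∈ D ∧ E.inField t (ρ r).1 r).card

/-- `req(F^t)`: the number of requests of `ρ` in slots of the field `F^t`. -/
noncomputable def fieldReq (E : TCPhase T α req) (ρ : ℕ → Request V) (t : ℕ) : ℕ :=
  E.fieldReqIn ρ t Set.univ t

/-- `size(F^t_{≤ τ} ∩ D)`: the number of distinct nodes having a slot in `F^t_{≤ τ} ∩ D`. -/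
noncomputable def fieldSizeIn (E : TCPhase T α req) (t : ℕ) (D : Set V) (τ : ℕ) : ℕ :=
  (Finset.univ.filter fun v : V => v ∈ D ∧ ∃ r, r ≤ τ ∧ E.inField t v r).card

/-- The standing assumption: no positive requests are given to cached nodes and no
negative requests to non-cached ones (so every request incurs cost `1` for `TC`). -/
def GoodReq (E : TCPhase T α req) : Prop :=
  ∀ t, 1 ≤ t →
    ((req t).2 = true → (req t).1 ∉ E.cache t) ∧
    ((req t).2 = false → (req t).1 ∈ E.cache t)

/-- The phase consists of rounds `1, …, tEnd`: no cache of `TC` before time `tEnd`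
exceeds the capacity `kONL` (at time `tEnd` the triggered fetch, if any, is performed
even if it exceeds the capacity, and is followed by the final eviction). -/
def PhaseEnd (E : TCPhase T α req) (kONL tEnd : ℕ) : Prop :=
  ∀ t, t < tEnd → (E.cache (t + 1)).ncard ≤ kONL

/-- `k_P`: the number of nodes in `TC`'s cache at the end of the phase
(after the fetch at time `tEnd`, before the final eviction). -/
noncomputable def kP (E : TCPhase T α req) (tEnd : ℕ) : ℕ :=
  (E.cache (tEnd + 1)).ncard

/-- The phase ending at `tEnd` is finished: the fetch at time `tEnd` exceeded the
capacity `kONL`. -/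
def FinishedAt (E : TCPhase T α req) (kONL tEnd : ℕ) : Prop :=
  E.PhaseEnd kONL tEnd ∧ kONL < E.kP tEnd

/-- `size(𝓕)`: the total size of all fields of the phase. -/
noncomputable def sizeFields (E : TCPhase T α req) (tEnd : ℕ) : ℕ :=
  ∑ t ∈ Finset.Icc 1 tEnd, chgSize (E.chg t)

/-- `req(F^∞)`: the number of requests of the phase lying in slots of the open field
(slots covered by no field of the phase). -/
noncomputable def openReq (E : TCPhase T α req) (tEnd : ℕ) : ℕ :=
  ((Finset.Icc 1 tEnd).filter fun r => ∀ t, t ≤ tEnd → ¬ E.inField t (req r).1 r).card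

/-- `TC(P)`: the total cost paid by `TC` during the phase: serving the requests,
fetching/evicting the applied changesets (`α` per node), and the final eviction
(`α · k_P`) if the phase is finished. -/
noncomputable def tcCost (E : TCPhase T α req) (kONL tEnd : ℕ) : ℕ :=
  ((Finset.Icc 1 tEnd).filter fun r => Costly (req r) (E.cache r)).card
  + α * E.sizeFields tEnd
  + (if kONL < E.kP tEnd then α * E.kP tEnd else 0)

/-- The tree cap `Y` (rooted at `u`, inside the negative field `F^t`) is proper for
the request sequence `ρ`: it holds `req(F^t ∩ Y) = |Y| · α`, and `F^t_{≤ τ} ∩ D` is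
not over-requested for every tree cap `D ⊆ Y` rooted at `u` and every time `τ ≤ t`. -/
def Proper (E : TCPhase T α req) (ρ : ℕ → Request V) (t : ℕ) (u : V) (Y : Set V) : Prop :=
  E.fieldReqIn ρ t Y t = Y.ncard * α ∧
  ∀ (D : Set V) (τ : ℕ), T.TreeCap u D → D ⊆ Y → τ ≤ t →
    E.fieldReqIn ρ t D τ ≤ E.fieldSizeIn t D τ * α

end TCPhase

/-- `D` is a feasible cache schedule for an (offline) algorithm with cache size `k`:
at every time the cache is a subforest of `T` of at most `k` nodes. -/
def IsSchedule {V : Type} (T : RTree V) (k : ℕ) (D : ℕ → Set V) : Prop :=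
  ∀ t, T.Subforest (D t) ∧ (D t).ncard ≤ k

/-- The cost of serving the requests of rounds `a, …, b` of `ρ` when the cache during
round `r` is `D r`. -/
noncomputable def serveCost {V : Type} (ρ : ℕ → Request V) (D : ℕ → Set V) (a b : ℕ) : ℕ :=
  ((Finset.Icc a b).filter fun r => Costly (ρ r) (D r)).card

/-- The reorganization cost of the schedule `D` (`α` per fetched or evicted node) over
the times `a, …, b - 1` (the change at time `t` leads from `D t` to `D (t+1)`). -/
noncomputable def moveCost {V : Type} (α : ℕ) (D : ℕ → Set V) (a b : ℕ) : ℕ :=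
  α * ∑ t ∈ Finset.Ico a b, ((D (t + 1) \ D t).ncard + (D t \ D (t + 1)).ncard)

/-- `OPT`: the minimum cost of serving rounds `a, …, b` of `ρ` by an offline algorithm
with cache size `k` that may start with an arbitrary cache. -/
noncomputable def optCostFrom {V : Type} (T : RTree V) (α k : ℕ)
    (ρ : ℕ → Request V) (a b : ℕ) : ℕ :=
  sInf {n | ∃ D : ℕ → Set V, IsSchedule T k D ∧
    n = serveCost ρ D a b + moveCost α D a b}

/-- `OPT`: the minimum cost of serving rounds `1, …, b` of `ρ` by an offline algorithm
with cache size `k` that starts with the empty cache. -/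
noncomputable def optCostEmpty {V : Type} (T : RTree V) (α k : ℕ)
    (ρ : ℕ → Request V) (b : ℕ) : ℕ :=
  sInf {n | ∃ D : ℕ → Set V, IsSchedule T k D ∧ D 0 = ∅ ∧
    n = serveCost ρ D 1 b + moveCost α D 0 b}

/-- `ρ'` is obtained from `ρ` by legally shifting requests: signs are preserved, every
positive request is moved to a descendant of its node (or kept), and every negative
request is moved to an ancestor of its node (or kept). -/
def LegalShift {V : Type} (T : RTree V) (ρ ρ' : ℕ → Request V) : Prop :=
  ∀ t, (ρ' t).2 = (ρ t).2 ∧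
    ((ρ t).2 = true → (ρ' t).1 ∈ T.subtree (ρ t).1) ∧
    ((ρ t).2 = false → (ρ t).1 ∈ T.subtree (ρ' t).1)

/-- A full run of the algorithm `TC` with cache capacity `kONL` on the request
sequence `req`, including phase restarts: whenever the fetch of a saturated changeset
would exceed the capacity, `TC` instead evicts its whole cache and a new phase starts
(`newPhase t` holds, and all counters are reset). -/
structure TCRun {V : Type} [Fintype V] [DecidableEq V]
    (T : RTree V) (α kONL : ℕ) (req : ℕ → Request V) where
  cache : ℕ → Set V
  cnt : ℕ → V → ℕ
  chg : ℕ → Option (Set V)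
  newPhase : ℕ → Prop
  cache_subforest : ∀ t, T.Subforest (cache t)
  cache_zero : cache 0 = ∅
  cnt_zero : ∀ v, cnt 0 v = 0
  capacity : ∀ t, (cache t).ncard ≤ kONL
  cnt_rec : ∀ t v, cnt (t + 1) v =
    (if newPhase t ∨ ∃ X, chg t = some X ∧ v ∈ X then 0 else cnt t v)
    + (if (req (t + 1)).1 = v ∧ Costly (req (t + 1)) (cache (t + 1)) then 1 else 0)
  step_some : ∀ t X, chg t = some X →
    T.Valid (cache t) X ∧
    X.ncard * α ≤ cntSum (cnt t) X ∧
    (∀ Y, T.Valid (cache t) Y → X ⊂ Y → cntSum (cnt t) Y < Y.ncard * α) ∧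
    ((T.ValidPos (cache t) X ∧ (cache t ∪ X).ncard ≤ kONL ∧
        cache (t + 1) = cache t ∪ X ∧ ¬ newPhase t) ∨
     (T.ValidPos (cache t) X ∧ kONL < (cache t ∪ X).ncard ∧
        cache (t + 1) = ∅ ∧ newPhase t) ∨
     (T.ValidNeg (cache t) X ∧ cache (t + 1) = cache t \ X ∧ ¬ newPhase t))
  step_none : ∀ t, chg t = none →
    cache (t + 1) = cache t ∧ ¬ newPhase t ∧
    ∀ X, T.Valid (cache t) X → cntSum (cnt t) X < X.ncard * α

/-- `TC(I)`: the total cost paid by the run `E` of `TC` on the rounds `1, …, N`: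
serving the requests, plus `α` per fetched/evicted node (on a phase restart the whole
cache is evicted). -/
noncomputable def TCRun.cost {V : Type} [Fintype V] [DecidableEq V]
    {T : RTree V} {α kONL : ℕ} {req : ℕ → Request V}
    (E : TCRun T α kONL req) (N : ℕ) : ℕ :=
  ((Finset.Icc 1 N).filter fun r => Costly (req r) (E.cache r)).card
  + α * ∑ t ∈ Finset.Icc 1 N,
      (if E.newPhase t then (E.cache t).ncard else chgSize (E.chg t))

namespace RTree

variable {V : Type} {T : RTree V} {C X Y : Set V}

theorem Subforest.inter {A B : Set V} (hA : T.Subforest A) (hB : T.Subforest B) :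
    T.Subforest (A ∩ B) :=
  fun v hv => Set.subset_inter (hA v hv.1) (hB v hv.2)

theorem Subforest.union {A B : Set V} (hA : T.Subforest A) (hB : T.Subforest B) :
    T.Subforest (A ∪ B) := by
  rintro v (hv | hv)
  · exact (hA v hv).trans Set.subset_union_left
  · exact (hB v hv).trans Set.subset_union_right

theorem Valid.nonempty (h : T.Valid C X) : X.Nonempty :=
  h.elim (·.1) (·.1)

theorem ValidPos.union (hX : T.ValidPos C X) (hY : T.ValidPos (C ∪ X) Y) :
    T.ValidPos C (X ∪ Y) ∧ Disjoint X Y := by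
  obtain ⟨hX₁, hX₂, -⟩ := hX
  obtain ⟨-, hY₂, hY₃⟩ := hY
  refine ⟨⟨hX₁.inl, ?_, by rwa [← Set.union_assoc]⟩, ?_⟩
  · ext v
    have := Set.ext_iff.1 hX₂ v
    have := Set.ext_iff.1 hY₂ v
    simp at *
    tauto
  · rw [Set.disjoint_left]
    intro v hv hv'
    exact (Set.ext_iff.1 hY₂ v).1 ⟨hv', Or.inr hv⟩

theorem ValidNeg.union (hX : T.ValidNeg C X) (hY : T.ValidNeg (C \ X) Y) :
    T.ValidNeg C (X ∪ Y) ∧ Disjoint X Y := by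
  obtain ⟨hX₁, hX₂, -⟩ := hX
  obtain ⟨-, hY₂, hY₃⟩ := hY
  refine ⟨⟨hX₁.inl, Set.union_subset hX₂ (hY₂.trans Set.sdiff_subset), ?_⟩, ?_⟩
  · rwa [← Set.sdiff_sdiff]
  · exact Set.disjoint_left.2 fun v hv hv' => (hY₂ hv').2 hv

/-- The part of an eviction after the fetch of `X` that avoids `X` was possible before it. -/
theorem ValidNeg.diff_of_union (hC : T.Subforest C) (hX : T.ValidPos C X)
    (hY : T.ValidNeg (C ∪ X) Y) (hne : (Y \ X).Nonempty) : T.ValidNeg C (Y \ X) := by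
  refine ⟨hne, fun v hv => (hY.2.1 hv.1).resolve_right hv.2, ?_⟩
  convert hY.2.2.inter hC using 1
  ext v
  have := Set.ext_iff.1 hX.2.1 v
  simp at *
  tauto

/-- The part of a fetch after the eviction of `X` that avoids `X` was possible before it. -/
theorem ValidPos.diff_of_diff (hC : T.Subforest C) (hX : T.ValidNeg C X)
    (hY : T.ValidPos (C \ X) Y) (hne : (Y \ X).Nonempty) : T.ValidPos C (Y \ X) := by
  refine ⟨hne, ?_, ?_⟩
  · ext v
    have := Set.ext_iff.1 hY.2.1 v
    simp at *
    tauto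
  · convert hY.2.2.union hC using 1
    ext v
    have := @hX.2.1 v
    simp at *
    tauto

/-- After applying a valid changeset `X`, any valid changeset either extends `X` to a larger
valid changeset for the old cache, or its part outside `X` was empty or already valid. -/
theorem Valid.after_change (hC : T.Subforest C) (hX : T.Valid C X)
    (hY : T.Valid (if T.ValidPos C X then C ∪ X else C \ X) Y) :
    (T.Valid C (X ∪ Y) ∧ Disjoint X Y) ∨ Y \ X = ∅ ∨ T.Valid C (Y \ X) := by
  rw [or_iff_not_imp_left, or_iff_not_imp_left, ← ne_eq, ← Set.nonempty_iff_ne_empty]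
  intro hU hne
  split_ifs at hY with hp
  · rcases hY with hY | hY
    · exact absurd ((hp.union hY).imp_left Or.inl) hU
    · exact Or.inr (hY.diff_of_union hC hp hne)
  · have hn := hX.resolve_left hp
    rcases hY with hY | hY
    · exact Or.inl (hY.diff_of_diff hC hn hne)
    · exact absurd ((hn.union hY).imp_left Or.inr) hU

end RTree

section cntSum

variable {V : Type} [Fintype V]

theorem cntSum_union (f : V → ℕ) {A B : Set V} (h : Disjoint A B) :
    cntSum f (A ∪ B) = cntSum f A + cntSum f B := by
  simp [cntSum, Set.indicator_union_of_disjoint h, Finset.sum_add_distrib]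

theorem cntSum_empty (f : V → ℕ) : cntSum f ∅ = 0 := by
  simp [cntSum]

end cntSum

namespace TCPhase

variable {V : Type} [Fintype V] [DecidableEq V]
  {T : RTree V} {α : ℕ} {req : ℕ → Request V}

theorem cntPost_of_none (E : TCPhase T α req) {t : ℕ} (h : E.chg t = none) :
    E.cntPost t = E.cnt t := by
  ext v
  simp [cntPost, h]

theorem cntSum_cntPost_of_some (E : TCPhase T α req) {t : ℕ} {X : Set V}
    (h : E.chg t = some X) (Y : Set V) :
    cntSum (E.cntPost t) Y = cntSum (E.cnt t) (Y \ X) := by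
  refine Finset.sum_congr rfl fun v _ => ?_
  by_cases hX : v ∈ X <;> by_cases hY : v ∈ Y <;> simp [cntPost, h, hX, hY]

/-- Serving one round raises the counter sum of `X` by at most one, and only if the requested
node lies in `X`. -/
theorem cntSum_cnt_succ_le (E : TCPhase T α req) (t : ℕ) (X : Set V) :
    cntSum (E.cnt (t + 1)) X ≤
      cntSum (E.cntPost t) X + if (req (t + 1)).1 ∈ X then 1 else 0 := by
  have h : ∀ v, X.indicator (E.cnt (t + 1)) v ≤ X.indicator (E.cntPost t) v +
      if (req (t + 1)).1 = v then (if (req (t + 1)).1 ∈ X then 1 else 0) else 0 := by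
    intro v
    by_cases hv : v ∈ X
    · simp only [Set.indicator_of_mem hv, E.cnt_rec, cntPost]
      gcongr
      split_ifs <;> simp_all
    · simp [hv]
  refine (Finset.sum_le_sum fun v _ => h v).trans ?_
  simp [Finset.sum_add_distrib, cntSum]

/-- If no changeset is over-saturated at time `t` and all saturated ones share the requested
node, then after the cache change at time `t` every valid changeset is unsaturated. -/
theorem cntSum_cntPost_lt (E : TCPhase T α req) (hα : 1 ≤ α) {t : ℕ}
    (hle : ∀ X, T.Valid (E.cache t) X → cntSum (E.cnt t) X ≤ X.ncard * α)
    (hmem : ∀ X, T.Valid (E.cache t) X → cntSum (E.cnt t) X = X.ncard * α → (req t).1 ∈ X)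
    {Y : Set V} (hY : T.Valid (E.cache (t + 1)) Y) :
    cntSum (E.cntPost t) Y < Y.ncard * α := by
  rcases hc : E.chg t with _ | X
  · obtain ⟨h₁, h₂⟩ := E.step_none t hc
    rw [E.cntPost_of_none hc]
    exact h₂ Y (h₁ ▸ hY)
  obtain ⟨hX, hsat, hmax, hcache⟩ := E.step_some t X hc
  have hXeq := le_antisymm (hle X hX) hsat
  rw [E.cntSum_cntPost_of_some hc]
  rw [hcache] at hY
  rcases hX.after_change (E.cache_subforest t) hY with ⟨hV, hd⟩ | he | hV
  · have hss : X ⊂ X ∪ Y := by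
      refine Set.ssubset_iff_subset_ne.2 ⟨Set.subset_union_left, fun he => ?_⟩
      obtain ⟨y, hy⟩ := hY.nonempty
      exact Set.disjoint_left.1 hd (he ▸ Or.inr hy) hy
    have hlt := hmax _ hV hss
    rw [cntSum_union _ hd, Set.ncard_union_eq hd, add_mul] at hlt
    rw [hd.symm.sdiff_eq_left]
    omega
  · rw [he, cntSum_empty]
    exact Nat.mul_pos hY.nonempty.ncard_pos hα
  · have hlt := (hle _ hV).lt_of_ne fun h => (hmem _ hV h).2 (hmem X hX hXeq)
    exact hlt.trans_le (Nat.mul_le_mul_right α (Set.ncard_le_ncard Set.sdiff_subset))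

theorem cntSum_cnt_succ_le_and_mem (E : TCPhase T α req) {t : ℕ} {X : Set V}
    (h : cntSum (E.cntPost t) X < X.ncard * α) :
    cntSum (E.cnt (t + 1)) X ≤ X.ncard * α ∧
      (cntSum (E.cnt (t + 1)) X = X.ncard * α → (req (t + 1)).1 ∈ X) := by
  have := E.cntSum_cnt_succ_le t X
  split_ifs at this with hr
  · exact ⟨by omega, fun _ => hr⟩
  · exact ⟨by omega, fun _ => by omega⟩

theorem cntSum_cnt_le_and_mem (E : TCPhase T α req) (hα : 1 ≤ α) (t : ℕ) :
    ∀ X, T.Valid (E.cache t) X → cntSum (E.cnt t) X ≤ X.ncard * α ∧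
      (cntSum (E.cnt t) X = X.ncard * α → (req t).1 ∈ X) := by
  induction t with
  | zero =>
    intro X hX
    have h0 : cntSum (E.cnt 0) X = 0 := by simp [cntSum, Set.indicator_apply, E.cnt_zero]
    have := Nat.mul_pos hX.nonempty.ncard_pos hα
    exact ⟨by omega, fun _ => by omega⟩
  | succ t ih =>
    intro X hX
    exact E.cntSum_cnt_succ_le_and_mem
      (E.cntSum_cntPost_lt hα (fun Y hY => (ih Y hY).1) (fun Y hY => (ih Y hY).2) hX)

end TCPhase

/-- the invariants of the technical claim, for any time `t > begin(P) = 0`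
of a phase of `TC`: (1) `cnt_{t-1}(X) < |X|·α` for every valid changeset `X` for `C_t`
(counters taken right after the cache change at time `t-1`);
(2) `cnt_t(X) ≤ |X|·α` for every valid changeset `X` for `C_t`;
(3) every valid changeset `X` for `C_t` with `cnt_t(X) = |X|·α` contains the node
requested at round `t`. -/
theorem tc_counter_invariants {V : Type} [Fintype V] [DecidableEq V]
    {T : RTree V} {α : ℕ} {req : ℕ → Request V}
    (E : TCPhase T α req) (hα : 1 ≤ α) (t : ℕ) (ht : 1 ≤ t) :
    (∀ X, T.Valid (E.cache t) X → cntSum (E.cntPost (t - 1)) X < X.ncard * α) ∧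
    (∀ X, T.Valid (E.cache t) X → cntSum (E.cnt t) X ≤ X.ncard * α) ∧
    (∀ X, T.Valid (E.cache t) X → cntSum (E.cnt t) X = X.ncard * α → (req t).1 ∈ X) := by
  obtain ⟨t, rfl⟩ := Nat.exists_eq_add_of_le' ht
  have h := E.cntSum_cnt_le_and_mem hα
  exact ⟨fun X hX => E.cntSum_cntPost_lt hα (fun Y hY => (h t Y hY).1)
      (fun Y hY => (h t Y hY).2) hX,
    fun X hX => (h _ X hX).1, fun X hX => (h _ X hX).2⟩
end

section
/- If a request sequence P' is created from a request sequence P by legally shifting requests, then OPT(P') ≤ OPT(P), where OPT denotes the minimum cost of serving the sequence by an offline algorithm with cache size k_OPT. -/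
open scoped Classical

/-- A legal shift of a request cannot make it costly for a subforest that served it for free. -/
theorem Costly.of_legalShift {V : Type} {T : RTree V} {ρ ρ' : ℕ → Request V}
    (hshift : LegalShift T ρ ρ') {C : Set V} (hC : T.Subforest C) {t : ℕ}
    (h : Costly (ρ' t) C) : Costly (ρ t) C := by
  obtain ⟨hsign, hpos, hneg⟩ := hshift t
  rcases h with ⟨hs, hv⟩ | ⟨hs, hv⟩
  · rw [hsign] at hs
    exact Or.inl ⟨hs, fun hmem => hv (hC _ hmem (hpos hs))⟩
  · rw [hsign] at hs
    exact Or.inr ⟨hs, hC _ hv (hneg hs)⟩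

/-- Every schedule serves the shifted sequence at no larger cost. -/
theorem serveCost_le_of_legalShift {V : Type} {T : RTree V} {ρ ρ' : ℕ → Request V}
    (hshift : LegalShift T ρ ρ') {k : ℕ} {D : ℕ → Set V} (hD : IsSchedule T k D) (a b : ℕ) :
    serveCost ρ' D a b ≤ serveCost ρ D a b :=
  Finset.card_le_card <|
    Finset.monotone_filter_right _ fun r _ h => Costly.of_legalShift hshift (hD r).1 h

/-- if `ρ'` is created from `ρ` by legally shifting the requests, then
`OPT(ρ') ≤ OPT(ρ)`, where `OPT` is the minimum cost of an offline algorithm with cache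
size `kOPT`. -/
theorem opt_legal_shift_mono {V : Type} [Fintype V] [DecidableEq V]
    (T : RTree V) (α kOPT : ℕ) (hα : 1 ≤ α)
    (ρ ρ' : ℕ → Request V) (hshift : LegalShift T ρ ρ') (N : ℕ) :
    optCostEmpty T α kOPT ρ' N ≤ optCostEmpty T α kOPT ρ N := by
  have hne : {n | ∃ D : ℕ → Set V, IsSchedule T kOPT D ∧ D 0 = ∅ ∧
      n = serveCost ρ D 1 N + moveCost α D 0 N}.Nonempty :=
    ⟨_, fun _ => ∅, fun _ => ⟨fun _ hv => hv.elim, by simp⟩, rfl, rfl⟩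
  obtain ⟨D, hD, hD0, hcost⟩ := Nat.sInf_mem hne
  have hle : optCostEmpty T α kOPT ρ' N ≤ serveCost ρ' D 1 N + moveCost α D 0 N :=
    Nat.sInf_le ⟨D, hD, hD0, rfl⟩
  exact hle.trans ((Nat.add_le_add_right (serveCost_le_of_legalShift hshift hD 1 N) _).trans
    hcost.ge)
end
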